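/- Let G be a finite simple graph with maximum degree Δ and let i_k(G) denote the number of independent sets of G of size k. Then for every k ≥ 0 with i_k(G) > 0 and i_{k+1}(G) > 0, (k+2)·i_{k+2}(G)·i_k(G) ≥ (k+1)·i_{k+1}(G)² − (Δ+1)·i_k(G)·i_{k+1}(G). Equivalently, setting q_k = (k+1)i_{k+1}(G)/i_k(G), one has q_{k+1} ≥ q_k − (Δ+1). -/

import Mathlib

open Finset

/- The finset of all independent sets (as finsets of vertices) of a graph `G`. -/
open Classical in
noncomputable def indepFinsets {V : Type*} [Fintype V] (G : SimpleGraph V) :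
    Finset (Finset V) :=
  Finset.univ.filter fun s => ∀ u ∈ s, ∀ v ∈ s, ¬ G.Adj u v

/- `numIndep G k` is the number `i_k(G)` of independent sets of `G` of size `k`. -/
noncomputable def numIndep {V : Type*} [Fintype V] (G : SimpleGraph V) (k : ℕ) : ℕ :=
  ((indepFinsets G).filter fun s => s.card = k).card

open Classical in
/-- The independent sets of `G` of size `k`. -/
noncomputable def indepFinsetsCard {V : Type*} [Fintype V] (G : SimpleGraph V) (k : ℕ) :
    Finset (Finset V) :=
  (indepFinsets G).filter fun s => s.card = k

open Classical in
/-- The vertices outside `s` whose insertion into `s` gives an independent set. -/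
noncomputable def extensionVertices {V : Type*} [Fintype V] (G : SimpleGraph V)
    (s : Finset V) : Finset V :=
  Finset.univ.filter fun v => v ∉ s ∧ insert v s ∈ indepFinsets G

lemma mem_indepFinsets {V : Type*} [Fintype V] {G : SimpleGraph V} {s : Finset V} :
    s ∈ indepFinsets G ↔ ∀ u ∈ s, ∀ v ∈ s, ¬ G.Adj u v := by
  simp [indepFinsets]

lemma mem_indepFinsetsCard {V : Type*} [Fintype V] {G : SimpleGraph V} {k : ℕ}
    {s : Finset V} : s ∈ indepFinsetsCard G k ↔ s ∈ indepFinsets G ∧ s.card = k := by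
  simp [indepFinsetsCard]

open Classical in
lemma mem_extensionVertices {V : Type*} [Fintype V] {G : SimpleGraph V} {s : Finset V}
    {v : V} : v ∈ extensionVertices G s ↔ v ∉ s ∧ insert v s ∈ indepFinsets G := by
  simp [extensionVertices]

lemma card_indepFinsetsCard {V : Type*} [Fintype V] (G : SimpleGraph V) (k : ℕ) :
    (indepFinsetsCard G k).card = numIndep G k := by
  unfold indepFinsetsCard numIndep
  congr

lemma mem_indepFinsets_of_subset {V : Type*} [Fintype V] {G : SimpleGraph V}
    {s t : Finset V} (ht : t ∈ indepFinsets G) (hst : s ⊆ t) : s ∈ indepFinsets G :=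
  mem_indepFinsets.2 fun u hu v hv => mem_indepFinsets.1 ht u (hst hu) v (hst hv)

open Classical in
/-- Double counting of pairs consisting of an independent set of size `k + 1` and one of its
vertices. -/
lemma sum_sum_extensionVertices {V : Type*} [Fintype V] (G : SimpleGraph V) (k : ℕ)
    (f : Finset V → ℕ) :
    ∑ s ∈ indepFinsetsCard G k, ∑ v ∈ extensionVertices G s, f (insert v s) =
      (k + 1) * ∑ t ∈ indepFinsetsCard G (k + 1), f t := by
  have h : (k + 1) * ∑ t ∈ indepFinsetsCard G (k + 1), f t =
      ∑ t ∈ indepFinsetsCard G (k + 1), ∑ _v ∈ t, f t := by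
    rw [Finset.mul_sum]
    refine Finset.sum_congr rfl fun t ht => ?_
    rw [Finset.sum_const, (mem_indepFinsetsCard.1 ht).2, smul_eq_mul]
  rw [h, Finset.sum_sigma', Finset.sum_sigma']
  refine Finset.sum_bij' (fun p _ => ⟨insert p.2 p.1, p.2⟩) (fun p _ => ⟨p.1.erase p.2, p.2⟩)
    ?_ ?_ ?_ ?_ ?_
  · rintro ⟨s, v⟩ h
    simp only [Finset.mem_sigma, mem_indepFinsetsCard, mem_extensionVertices] at h ⊢
    obtain ⟨⟨-, hs⟩, hv, hi⟩ := h
    exact ⟨⟨hi, by rw [Finset.card_insert_of_notMem hv, hs]⟩, Finset.mem_insert_self _ _⟩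
  · rintro ⟨t, v⟩ h
    simp only [Finset.mem_sigma, mem_indepFinsetsCard, mem_extensionVertices] at h ⊢
    obtain ⟨⟨hi, ht⟩, hv⟩ := h
    refine ⟨⟨mem_indepFinsets_of_subset hi (Finset.erase_subset _ _), ?_⟩,
      Finset.notMem_erase _ _, ?_⟩
    · rw [Finset.card_erase_of_mem hv, ht, Nat.add_sub_cancel]
    · rwa [Finset.insert_erase hv]
  · rintro ⟨s, v⟩ h
    simp only [Finset.mem_sigma, mem_extensionVertices] at h
    simp [Finset.erase_insert h.2.1]
  · rintro ⟨t, v⟩ h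
    simp only [Finset.mem_sigma] at h
    simp [Finset.insert_erase h.2]
  · intros
    rfl

lemma sum_card_extensionVertices {V : Type*} [Fintype V] (G : SimpleGraph V) (k : ℕ) :
    ∑ s ∈ indepFinsetsCard G k, (extensionVertices G s).card =
      (k + 1) * numIndep G (k + 1) := by
  simpa [card_indepFinsetsCard] using sum_sum_extensionVertices G k fun _ => 1

open Classical in
lemma card_extensionVertices_le {V : Type*} [Fintype V] (G : SimpleGraph V)
    [DecidableRel G.Adj] {s : Finset V} {v : V} (hv : v ∈ extensionVertices G s) :
    (extensionVertices G s).card ≤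
      (extensionVertices G (insert v s)).card + (G.maxDegree + 1) := by
  have hsub : extensionVertices G s ⊆
      extensionVertices G (insert v s) ∪ insert v (G.neighborFinset v) := by
    intro w hw
    by_cases hmem : w ∈ insert v (G.neighborFinset v)
    · exact Finset.mem_union_right _ hmem
    refine Finset.mem_union_left _ ?_
    simp only [Finset.mem_insert, SimpleGraph.mem_neighborFinset, not_or] at hmem
    simp only [mem_extensionVertices, mem_indepFinsets, Finset.mem_insert] at hv hw ⊢
    grind [G.adj_comm, G.irrefl]
  have hN : (insert v (G.neighborFinset v)).card ≤ G.maxDegree + 1 :=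
    (Finset.card_insert_le _ _).trans (Nat.succ_le_succ (G.degree_le_maxDegree v))
  exact (Finset.card_le_card hsub).trans ((Finset.card_union_le _ _).trans (by gcongr))

lemma sum_card_extensionVertices_sq_le {V : Type*} [Fintype V] (G : SimpleGraph V)
    [DecidableRel G.Adj] (k : ℕ) :
    ∑ s ∈ indepFinsetsCard G k, (extensionVertices G s).card ^ 2 ≤
      (k + 1) * ((k + 2) * numIndep G (k + 2)) +
        (G.maxDegree + 1) * ((k + 1) * numIndep G (k + 1)) := by
  classical
  rw [← sum_card_extensionVertices G (k + 1), ← sum_card_extensionVertices G k,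
    ← sum_sum_extensionVertices, Finset.mul_sum, ← Finset.sum_add_distrib]
  refine Finset.sum_le_sum fun s _ => ?_
  calc (extensionVertices G s).card ^ 2
      = ∑ _v ∈ extensionVertices G s, (extensionVertices G s).card := by
        rw [Finset.sum_const, smul_eq_mul, sq]
    _ ≤ ∑ v ∈ extensionVertices G s,
          ((extensionVertices G (insert v s)).card + (G.maxDegree + 1)) :=
        Finset.sum_le_sum fun v hv => card_extensionVertices_le G hv
    _ = _ := by rw [Finset.sum_add_distrib, Finset.sum_const, smul_eq_mul, mul_comm (_ + 1)]

/-- For a graph `G` with maximum degree `Δ` and every `k ≥ 0` with `i_k(G) > 0` and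
`i_{k+1}(G) > 0`,
`(k+2)·i_{k+2}(G)·i_k(G) ≥ (k+1)·i_{k+1}(G)² − (Δ+1)·i_k(G)·i_{k+1}(G)`;
equivalently, with `q_k = (k+1)i_{k+1}(G)/i_k(G)`, one has `q_{k+1} ≥ q_k − (Δ+1)`. -/
theorem indep_count_supermultiplicative {V : Type*} [Fintype V] (G : SimpleGraph V)
    [DecidableRel G.Adj] (Δ : ℕ) (hΔ : G.maxDegree = Δ) (k : ℕ)
    (hk : 0 < numIndep G k) (hk1 : 0 < numIndep G (k + 1)) :
    ((k : ℝ) + 2) * numIndep G (k + 2) * numIndep G k ≥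
      ((k : ℝ) + 1) * (numIndep G (k + 1) : ℝ) ^ 2 -
        ((Δ : ℝ) + 1) * numIndep G k * numIndep G (k + 1) := by
  have hcs : ((k + 1) * numIndep G (k + 1)) ^ 2 ≤ numIndep G k *
      ((k + 1) * ((k + 2) * numIndep G (k + 2)) +
        (Δ + 1) * ((k + 1) * numIndep G (k + 1))) := by
    rw [← hΔ, ← sum_card_extensionVertices G k, ← card_indepFinsetsCard G k]
    refine sq_sum_le_card_mul_sum_sq.trans (Nat.mul_le_mul_left _ ?_)
    rw [sum_card_extensionVertices G k]
    exact sum_card_extensionVertices_sq_le G k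
  have hcs' : (((k : ℝ) + 1) * numIndep G (k + 1)) ^ 2 ≤ numIndep G k *
      (((k : ℝ) + 1) * (((k : ℝ) + 2) * numIndep G (k + 2)) +
        ((Δ : ℝ) + 1) * (((k : ℝ) + 1) * numIndep G (k + 1))) := by
    exact_mod_cast hcs
  have hpos : (0 : ℝ) < (k : ℝ) + 1 := by positivity
  refine le_of_mul_le_mul_left ?_ hpos
  linarith
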